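/- Let β ∈ (0,1) be the solution of sin(2πβ) − sin(πβ) = βπ cos(πβ) (numerically β ≈ 0.7542), and define Γ : [0,1] → [0,1] by Γ(x) = β − x for x ∈ [0,β) and Γ(x) = x for x ∈ [β,1]. Then the pushforward of the Lebesgue measure on [0,1] under the map x ↦ (x, Γ(x)) maximizes ∫_{[0,1]²} sin(π(x+y)) dγ over all copula measures γ. -/

import Mathlib

open MeasureTheory Real

/-- The uniform (Lebesgue) measure on `[0,1]`. -/
noncomputable def unif : Measure ℝ := volume.restrict (Set.Icc (0:ℝ) 1)

/-- A copula measure: a Borel probability measure on `[0,1]²` (viewed inside `ℝ × ℝ`)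
whose two marginals are the uniform measure on `[0,1]`. -/
def IsCopula (γ : Measure (ℝ × ℝ)) : Prop :=
  IsProbabilityMeasure γ ∧ γ.map Prod.fst = unif ∧ γ.map Prod.snd = unif

lemma sin_sub_sin_le_mul_cos {a t : ℝ} (ha : 0 ≤ a) (hat : a ≤ t) (ht : t ≤ π) :
    sin t - sin a ≤ cos a * (t - a) := by
  refine Convex.image_sub_le_mul_sub_of_deriv_le (convex_Icc a t) continuous_sin.continuousOn
    differentiable_sin.differentiableOn (fun x hx => ?_) a ⟨le_rfl, hat⟩ t ⟨hat, le_rfl⟩ hat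
  rw [interior_Icc] at hx
  rw [Real.deriv_sin]
  exact cos_le_cos_of_nonneg_of_le_pi ha (hx.2.le.trans ht) hx.1.le

lemma mul_cos_le_sin_sub_sin {a t : ℝ} (ha : 0 ≤ a) (hat : a ≤ t) (ht : t ≤ π) :
    cos t * (t - a) ≤ sin t - sin a := by
  refine Convex.mul_sub_le_image_sub_of_le_deriv (convex_Icc a t) continuous_sin.continuousOn
    differentiable_sin.differentiableOn (fun x hx => ?_) a ⟨le_rfl, hat⟩ t ⟨hat, le_rfl⟩ hat
  rw [interior_Icc] at hx
  rw [Real.deriv_sin]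
  exact cos_le_cos_of_nonneg_of_le_pi (ha.trans hx.1.le) ht hx.2.le

/-- The sine lies below its tangent line at a point of `[0, π]`, on all of `[0, π]`. -/
lemma sin_le_tangent {b t : ℝ} (hb : b ∈ Set.Icc 0 π) (ht : t ∈ Set.Icc 0 π) :
    sin t ≤ sin b + cos b * (t - b) := by
  rcases le_total b t with h | h
  · linarith [sin_sub_sin_le_mul_cos hb.1 h ht.2]
  · linarith [mul_cos_le_sin_sub_sin ht.1 h hb.2]

/-- An affine function below the sine at two points of `[0, π]` is below it in between. -/
lemma affine_le_sin {A B p q s : ℝ} (hp : 0 ≤ p) (hq : q ≤ π) (hps : p ≤ s) (hsq : s ≤ q)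
    (h₁ : A + B * p ≤ sin p) (h₂ : A + B * q ≤ sin q) : A + B * s ≤ sin s := by
  have hs : s ∈ segment ℝ p q := by
    rw [segment_eq_Icc (hps.trans hsq)]
    exact ⟨hps, hsq⟩
  obtain ⟨a, c, ha, hc, hac, rfl⟩ := hs
  have hpq := hps.trans hsq
  have h := strictConcaveOn_sin_Icc.concaveOn.2 (show p ∈ Set.Icc 0 π from ⟨hp, hpq.trans hq⟩)
    (show q ∈ Set.Icc 0 π from ⟨hp.trans hpq, hq⟩) ha hc hac
  simp only [smul_eq_mul] at h ⊢
  have e : A + B * (a * p + c * q) = a * (A + B * p) + c * (A + B * q) := by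
    linear_combination (-A) * hac
  rw [e]
  exact (add_le_add (mul_le_mul_of_nonneg_left h₁ ha) (mul_le_mul_of_nonneg_left h₂ hc)).trans h

lemma cos_le_neg_half_of_sin_two_mul_sub {b : ℝ} (hb : 0 < b) (hb' : b < π)
    (h : sin (2 * b) - sin b = b * cos b) : cos b ≤ -(1 / 2) := by
  by_contra! hc
  have hs : 0 < sin b := sin_pos_of_pos_of_lt_pi hb hb'
  have hsb : sin b < b := sin_lt hb
  have hc1 : cos b < 1 := by
    simpa using cos_lt_cos_of_nonneg_of_le_pi le_rfl hb'.le hb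
  have hsq := sin_sq_add_cos_sq b
  rw [sin_two_mul] at h
  rcases le_or_gt (cos b) 0 with h0 | h0
  · have hs' : 0.86 ≤ sin b := by nlinarith
    have := pi_lt_d2
    nlinarith
  · nlinarith [mul_pos hs (sub_pos.2 hc1), mul_pos h0 (sub_pos.2 hsb)]

lemma sin_two_mul_half_sub_sin_le {b v : ℝ} (hb : 0 ≤ b) (hbv : b ≤ v) (hv : v ≤ π)
    (hc : cos b ≤ -(1 / 2)) :
    sin (2 * b) / 2 - sin b ≤ sin (2 * v) / 2 - sin v := by
  obtain ⟨m, d, rfl, rfl⟩ : ∃ m d, b = m - d ∧ v = m + d :=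
    ⟨(b + v) / 2, (v - b) / 2, by ring, by ring⟩
  have hd : 0 ≤ d := by linarith
  have hsd : 0 ≤ sin d := sin_nonneg_of_nonneg_of_le_pi hd (by linarith)
  have hcd : 0 ≤ cos d := cos_nonneg_of_neg_pi_div_two_le_of_le (by linarith) (by linarith)
  have hcm : cos m ≤ -(1 / 2) :=
    (cos_le_cos_of_nonneg_of_le_pi hb (by linarith) (by linarith)).trans hc
  have key : cos m ≤ cos d * cos (2 * m) := by
    rw [cos_two_mul]
    rcases le_total 0 (2 * cos m ^ 2 - 1) with h | h
    · nlinarith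
    · nlinarith [cos_le_one d, neg_one_le_cos m]
  have e : sin (2 * (m + d)) / 2 - sin (m + d) - (sin (2 * (m - d)) / 2 - sin (m - d))
      = 2 * sin d * (cos d * cos (2 * m) - cos m) := by
    rw [mul_add, mul_sub, sin_add, sin_sub, sin_add, sin_sub, sin_two_mul d]
    ring
  have := mul_nonneg (mul_nonneg zero_le_two hsd) (sub_nonneg.2 key)
  linarith

/-- The dual potential certifying optimality, in radians. -/
noncomputable def sinePotential (b u : ℝ) : ℝ :=
  if u ≤ b then sin b / 2 + cos b * (u - b / 2) else sin (2 * u) / 2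

lemma sinePotential_of_le {b u : ℝ} (h : u ≤ b) :
    sinePotential b u = sin b / 2 + cos b * (u - b / 2) := if_pos h

lemma sinePotential_of_ge {b u : ℝ} (hb : sin (2 * b) - sin b = b * cos b) (h : b ≤ u) :
    sinePotential b u = sin (2 * u) / 2 := by
  rcases h.eq_or_lt with rfl | h
  · rw [sinePotential_of_le le_rfl]
    linarith
  · exact if_neg h.not_ge

lemma continuous_sinePotential {b : ℝ} (hb : sin (2 * b) - sin b = b * cos b) :
    Continuous (sinePotential b) := by
  refine Continuous.if_le (by fun_prop) (by fun_prop) continuous_id continuous_const ?_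
  rintro u rfl
  linarith

lemma sin_add_le_half_sin_two_mul_add {u v : ℝ} (h : π ≤ u + v) (h' : u + v ≤ 2 * π) :
    sin (u + v) ≤ sin (2 * u) / 2 + sin (2 * v) / 2 := by
  have hs : sin (u + v) ≤ 0 := by
    have := sin_nonneg_of_nonneg_of_le_pi (sub_nonneg.2 h) (by linarith)
    rw [sin_sub_pi] at this
    linarith
  have e : sin (2 * u) / 2 + sin (2 * v) / 2 = sin (u + v) * cos (u - v) := by
    rw [show 2 * u = (u + v) + (u - v) by ring, show 2 * v = (u + v) - (u - v) by ring,
      sin_add (u + v), sin_sub (u + v)]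
    ring
  rw [e]
  nlinarith [cos_le_one (u - v)]

lemma sin_add_le_sinePotential_add {b u v : ℝ} (hb : 0 < b) (hb' : b < π)
    (h : sin (2 * b) - sin b = b * cos b) (hu : u ∈ Set.Icc 0 π) (hv : v ∈ Set.Icc 0 π) :
    sin (u + v) ≤ sinePotential b u + sinePotential b v := by
  have hc := cos_le_neg_half_of_sin_two_mul_sub hb hb' h
  have hb2 : π / 2 < b := by
    by_contra! h2
    linarith [cos_nonneg_of_neg_pi_div_two_le_of_le (by linarith [pi_pos]) h2]
  wlog huv : u ≤ v generalizing u v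
  · rw [add_comm u, add_comm (sinePotential b u)]
    exact this hv hu (le_of_not_ge huv)
  obtain ⟨hu0, huπ⟩ := hu
  obtain ⟨hv0, hvπ⟩ := hv
  rcases le_total v b with hvb | hbv
  · rw [sinePotential_of_le hvb, sinePotential_of_le (huv.trans hvb)]
    suffices H : sin (u + v) ≤ sin b + cos b * (u + v - b) by linarith
    rcases le_total (u + v) π with hπ | hπ
    · exact sin_le_tangent ⟨hb.le, hb'.le⟩ ⟨by linarith, hπ⟩
    · have h₁ := sin_le_tangent ⟨hb.le, hb'.le⟩ (show π ∈ Set.Icc 0 π from ⟨pi_pos.le, le_rfl⟩)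
      rw [sin_pi] at h₁
      have := affine_le_sin (A := -(sin b + cos b * (π - b))) (B := -cos b) (p := 0)
        (q := 2 * b - π) (s := u + v - π) le_rfl (by linarith) (by linarith) (by linarith)
        (by rw [sin_zero]; linarith) (by rw [sin_sub_pi]; linarith)
      rw [sin_sub_pi] at this
      linarith
  rw [sinePotential_of_ge h hbv]
  rcases le_total b u with hbu | hub
  · rw [sinePotential_of_ge h hbu]
    exact sin_add_le_half_sin_two_mul_add (by linarith) (by linarith)
  rw [sinePotential_of_le hub]
  have hmono := sin_two_mul_half_sub_sin_le hb.le hbv hvπ hc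
  have hcos := cos_le_cos_of_nonneg_of_le_pi hb.le hvπ hbv
  have below : ∀ w, 0 ≤ w → w + v ≤ π →
      sin (w + v) ≤ sin b / 2 + cos b * (w - b / 2) + sin (2 * v) / 2 := by
    intro w hw hwv
    have h₁ := sin_sub_sin_le_mul_cos hv0 (by linarith : v ≤ w + v) hwv
    nlinarith [mul_le_mul_of_nonneg_right hcos hw]
  rcases le_total (u + v) π with hπ | hπ
  · exact below u hu0 hπ
  · have h₁ := below (π - v) (by linarith) (by linarith)
    rw [sub_add_cancel, sin_pi] at h₁
    have h₂ := sin_add_le_half_sin_two_mul_add (u := b) (v := v) (by linarith) (by linarith)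
    have := affine_le_sin (A := -(sin b / 2 + cos b * (π - v - b / 2) + sin (2 * v) / 2))
      (B := -cos b) (p := 0) (q := b + v - π) (s := u + v - π) le_rfl (by linarith)
      (by linarith) (by linarith) (by rw [sin_zero]; linarith) (by rw [sin_sub_pi]; linarith)
    rw [sin_sub_pi] at this
    linarith

lemma sinePotential_add_reflect {b u : ℝ} (hu : 0 ≤ u) (hub : u ≤ b) :
    sinePotential b u + sinePotential b (b - u) = sin b := by
  rw [sinePotential_of_le hub, sinePotential_of_le (by linarith)]
  ring

instance : IsProbabilityMeasure unif := ⟨by simp [unif]⟩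

lemma measurable_flip_below (β : ℝ) : Measurable fun x : ℝ => if x < β then β - x else x :=
  Measurable.ite measurableSet_Iio (by fun_prop) measurable_id

lemma map_flip_below_unif {β : ℝ} (hβ : β ∈ Set.Icc (0 : ℝ) 1) :
    unif.map (fun x => if x < β then β - x else x) = unif := by
  have hu : unif = volume.restrict (Set.Ico 0 β) + volume.restrict (Set.Icc β 1) := by
    rw [unif, ← Set.Ico_union_Icc_eq_Icc hβ.1 hβ.2]
    refine Measure.restrict_union ?_ measurableSet_Icc
    exact Set.disjoint_left.2 fun x hx hx' => hx.2.not_ge hx'.1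
  have h₁ : (volume.restrict (Set.Ico 0 β)).map (fun x => if x < β then β - x else x)
      = volume.restrict (Set.Ico 0 β) := by
    rw [Measure.map_congr (g := fun x => β - x)]
    · have := ((Measure.measurePreserving_sub_left volume β).restrict_preimage
        (measurableSet_Ioc (a := (0 : ℝ)) (b := β))).map_eq
      rw [Set.preimage_const_sub_Ioc, sub_self, sub_zero] at this
      rw [this]
      exact Measure.restrict_congr_set Ioc_ae_eq_Icc |>.trans
        (Measure.restrict_congr_set Ico_ae_eq_Icc).symm
    · filter_upwards [ae_restrict_mem measurableSet_Ico] with x hx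
      exact if_pos hx.2
  have h₂ : (volume.restrict (Set.Icc β 1)).map (fun x => if x < β then β - x else x)
      = volume.restrict (Set.Icc β 1) := by
    rw [Measure.map_congr (g := id), Measure.map_id]
    filter_upwards [ae_restrict_mem measurableSet_Icc] with x hx
    exact if_neg hx.1.not_gt
  rw [hu, Measure.map_add _ _ (measurable_flip_below β), h₁, h₂]

lemma IsCopula.graph {f : ℝ → ℝ} (hf : Measurable f) (h : unif.map f = unif) :
    IsCopula (unif.map fun x => (x, f x)) := by
  have hm : Measurable fun x => (x, f x) := measurable_id.prodMk hf
  refine ⟨Measure.isProbabilityMeasure_map hm.aemeasurable, ?_, ?_⟩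
  · rw [Measure.map_map measurable_fst hm]
    exact Measure.map_id
  · rw [Measure.map_map measurable_snd hm]
    exact h

lemma IsCopula.ae_mem {γ : Measure (ℝ × ℝ)} (hγ : IsCopula γ) :
    ∀ᵐ p ∂γ, p.1 ∈ Set.Icc (0 : ℝ) 1 ∧ p.2 ∈ Set.Icc (0 : ℝ) 1 := by
  have hu : ∀ᵐ x ∂unif, x ∈ Set.Icc (0 : ℝ) 1 := ae_restrict_mem measurableSet_Icc
  have h₁ := hu
  rw [← hγ.2.1] at h₁
  have h₂ := hu
  rw [← hγ.2.2] at h₂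
  exact (ae_of_ae_map measurable_fst.aemeasurable h₁).and
    (ae_of_ae_map measurable_snd.aemeasurable h₂)

lemma IsCopula.integrable_comp_fst_snd {γ : Measure (ℝ × ℝ)} (hγ : IsCopula γ) {g : ℝ → ℝ}
    (hg : Integrable g unif) :
    Integrable (fun p => g p.1) γ ∧ Integrable (fun p => g p.2) γ := by
  have h₁ := hg
  rw [← hγ.2.1] at h₁
  have h₂ := hg
  rw [← hγ.2.2] at h₂
  exact ⟨h₁.comp_measurable measurable_fst, h₂.comp_measurable measurable_snd⟩

lemma IsCopula.integral_add_marginals {γ : Measure (ℝ × ℝ)} (hγ : IsCopula γ) {g : ℝ → ℝ}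
    (hg : Continuous g) (hgi : Integrable g unif) :
    ∫ p, (g p.1 + g p.2) ∂γ = 2 * ∫ x, g x ∂unif := by
  obtain ⟨h₁, h₂⟩ := hγ.integrable_comp_fst_snd hgi
  rw [MeasureTheory.integral_add h₁ h₂, two_mul]
  congr 1
  · rw [← hγ.2.1, integral_map measurable_fst.aemeasurable hg.aestronglyMeasurable]
  · rw [← hγ.2.2, integral_map measurable_snd.aemeasurable hg.aestronglyMeasurable]

/-- **The sine example.** Let `β ∈ (0,1)` solve `sin(2πβ) − sin(πβ) = βπ cos(πβ)`
(numerically `β ≈ 0.7542`), and let `Γ(x) = β − x` on `[0,β)`, `Γ(x) = x` on `[β,1]`.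
Then the pushforward of the uniform measure on `[0,1]` under `x ↦ (x, Γ x)` maximizes
`∫ sin(π(x+y)) dγ` over all copula measures `γ`. -/
theorem stmt_12 (β : ℝ) (hβ : β ∈ Set.Ioo (0:ℝ) 1)
    (hβeq : Real.sin (2 * π * β) - Real.sin (π * β) = β * π * Real.cos (π * β)) :
    IsCopula (unif.map fun x => (x, if x < β then β - x else x)) ∧
    ∀ γ : Measure (ℝ × ℝ), IsCopula γ →
      ∫ p, Real.sin (π * (p.1 + p.2)) ∂γ
        ≤ ∫ p, Real.sin (π * (p.1 + p.2))
            ∂(unif.map fun x => (x, if x < β then β - x else x)) := by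
  have hmeas := measurable_flip_below β
  have hcop := IsCopula.graph hmeas (map_flip_below_unif ⟨hβ.1.le, hβ.2.le⟩)
  refine ⟨hcop, fun γ hγ => ?_⟩
  have hb : 0 < π * β := mul_pos pi_pos hβ.1
  have hb' : π * β < π := mul_lt_of_lt_one_right pi_pos hβ.2
  have h : sin (2 * (π * β)) - sin (π * β) = π * β * cos (π * β) := by
    rw [← mul_assoc, hβeq, mul_comm β]
  set g : ℝ → ℝ := fun x => sinePotential (π * β) (π * x) with hg_def
  have hg : Continuous g := (continuous_sinePotential h).comp (continuous_const_mul π)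
  have hgi : Integrable g unif := hg.continuousOn.integrableOn_Icc
  have mem {x : ℝ} (hx : x ∈ Set.Icc (0 : ℝ) 1) : π * x ∈ Set.Icc 0 π :=
    ⟨mul_nonneg pi_pos.le hx.1, mul_le_of_le_one_right pi_pos.le hx.2⟩
  have hsin : Continuous fun p : ℝ × ℝ => sin (π * (p.1 + p.2)) := by fun_prop
  have : IsProbabilityMeasure γ := hγ.1
  obtain ⟨hg₁, hg₂⟩ := hγ.integrable_comp_fst_snd hgi
  calc ∫ p, sin (π * (p.1 + p.2)) ∂γ ≤ ∫ p, (g p.1 + g p.2) ∂γ := by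
        refine integral_mono_ae ?_ (hg₁.add hg₂) ?_
        · exact Integrable.of_bound hsin.aestronglyMeasurable 1
            (.of_forall fun p => abs_sin_le_one _)
        · filter_upwards [hγ.ae_mem] with p hp
          rw [mul_add]
          exact sin_add_le_sinePotential_add hb hb' h (mem hp.1) (mem hp.2)
    _ = ∫ p, (g p.1 + g p.2) ∂(unif.map fun x => (x, if x < β then β - x else x)) := by
        rw [hγ.integral_add_marginals hg hgi, hcop.integral_add_marginals hg hgi]
    _ = _ := by
        have hpair := (measurable_id.prodMk hmeas).aemeasurable (μ := unif)
        have hgg : Continuous fun p : ℝ × ℝ => g p.1 + g p.2 := by fun_prop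
        refine integral_congr_ae ((ae_map_iff hpair
          (measurableSet_eq_fun hgg.measurable hsin.measurable)).2 ?_)
        have hu : ∀ᵐ x ∂unif, x ∈ Set.Icc (0 : ℝ) 1 := ae_restrict_mem measurableSet_Icc
        filter_upwards [hu] with x hx
        simp only [id, hg_def]
        split_ifs with hxβ
        · rw [mul_sub, sinePotential_add_reflect (mem hx).1
            (mul_le_mul_of_nonneg_left hxβ.le pi_pos.le), add_sub_cancel]
        · rw [sinePotential_of_ge h (mul_le_mul_of_nonneg_left (not_lt.1 hxβ) pi_pos.le)]
          ring_nf
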